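/- Let K be an algebraically closed field with char K ≠ 2, and let z, t be distinct commuting involutions in PGL₂(K). Then z and t are conjugate in PGL₂(K) by an element r that also conjugates t to z, i.e., there exists r ∈ PGL₂(K) with r z r⁻¹ = t and r t r⁻¹ = z. -/

import Mathlib

open Matrix

/-- `PGL₂(K)`: the quotient of `GL₂(K)` by its center. -/
abbrev PGL2 (K : Type*) [Field K] : Type _ :=
  GL (Fin 2) K ⧸ Subgroup.center (GL (Fin 2) K)

/-- The action of a matrix `g ∈ GL₂(K)` on the projective line `ℙ¹(K)`
(Möbius transformations). -/
noncomputable def glSMul {K : Type*} [Field K] (g : GL (Fin 2) K)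
    (x : Projectivization K (Fin 2 → K)) : Projectivization K (Fin 2 → K) :=
  Projectivization.map ((g : Matrix (Fin 2) (Fin 2) K).mulVecLin)
    (Function.LeftInverse.injective (g := ((↑(g⁻¹) : Matrix (Fin 2) (Fin 2) K).mulVecLin))
      (fun v => by
        show (↑g⁻¹ : Matrix (Fin 2) (Fin 2) K).mulVec
            ((↑g : Matrix (Fin 2) (Fin 2) K).mulVec v) = v
        rw [Matrix.mulVec_mulVec]
        have h : ((↑(g⁻¹) : Matrix (Fin 2) (Fin 2) K) * (↑g : Matrix (Fin 2) (Fin 2) K)) = 1 := g.inv_mul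
        rw [h, Matrix.one_mulVec])) x

theorem pgl_mk_eq_iff {K : Type*} [Field K] (X Y : GL (Fin 2) K) :
    ((X : PGL2 K) = (Y : PGL2 K)) ↔
      ∃ c : K, (X : Matrix (Fin 2) (Fin 2) K) = c • (Y : Matrix (Fin 2) (Fin 2) K) := by
  rw [eq_comm, QuotientGroup.eq, Matrix.GeneralLinearGroup.mem_center_iff_val_mem_range_scalar]
  constructor
  · rintro ⟨c, hc⟩
    refine ⟨c, ?_⟩
    have h : (X : Matrix (Fin 2) (Fin 2) K) = (Y : Matrix (Fin 2) (Fin 2) K) * ((Y⁻¹ * X : GL (Fin 2) K) : Matrix (Fin 2) (Fin 2) K) := by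
      rw [← Units.val_mul, mul_inv_cancel_left]
    rw [h, ← hc]
    simp [← Matrix.smul_one_eq_diagonal]
  · rintro ⟨c, hc⟩
    refine ⟨c, ?_⟩
    rw [Units.val_mul, hc, Matrix.mul_smul, Units.inv_mul]
    simp [← Matrix.smul_one_eq_diagonal]

theorem traceless_of_sq {K : Type*} [Field K] (hchar : (2 : K) ≠ 0)
    (A : Matrix (Fin 2) (Fin 2) K) (a : K) (h : A * A = a • 1) (hn : ¬ ∃ c : K, A = c • 1) :
    A 1 1 = - A 0 0 := by
  have h00 := congrFun (congrFun h 0) 0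
  have h01 := congrFun (congrFun h 0) 1
  have h10 := congrFun (congrFun h 1) 0
  have h11 := congrFun (congrFun h 1) 1
  simp [Matrix.mul_apply, Fin.sum_univ_two] at h00 h01 h10 h11
  by_contra hs
  have hs' : A 0 0 + A 1 1 ≠ 0 := fun e => hs (by linear_combination e)
  have e01 : A 0 1 = 0 := (mul_eq_zero.1 (by linear_combination h01 :
    (A 0 0 + A 1 1) * A 0 1 = 0)).resolve_left hs'
  have e10 : A 1 0 = 0 := (mul_eq_zero.1 (by linear_combination h10 :
    (A 0 0 + A 1 1) * A 1 0 = 0)).resolve_left hs'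
  have e : A 0 0 - A 1 1 = 0 := (mul_eq_zero.1 (by linear_combination h00 - h11 :
    (A 0 0 + A 1 1) * (A 0 0 - A 1 1) = 0)).resolve_left hs'
  refine hn ⟨A 0 0, ?_⟩
  ext i j
  fin_cases i <;> fin_cases j <;> simp [e01, e10]
  linear_combination -e

/-- Let `K` be algebraically closed with `char K ≠ 2`, and let `z, t` be
distinct commuting involutions in `PGL₂(K)`. Then there exists `r ∈ PGL₂(K)` with
`r z r⁻¹ = t` and `r t r⁻¹ = z`. -/
theorem stmt_11 (K : Type*) [Field K] [IsAlgClosed K] (hchar : (2 : K) ≠ 0)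
    (z t : PGL2 K) (hz2 : z * z = 1) (hz1 : z ≠ 1) (ht2 : t * t = 1) (ht1 : t ≠ 1)
    (hcomm : Commute z t) (hzt : z ≠ t) :
    ∃ r : PGL2 K, r * z * r⁻¹ = t ∧ r * t * r⁻¹ = z := by
  induction z using QuotientGroup.induction_on with | H A => ?_
  induction t using QuotientGroup.induction_on with | H B => ?_
  rw [← QuotientGroup.mk_mul, ← QuotientGroup.mk_one, pgl_mk_eq_iff] at hz2 ht2
  rw [← QuotientGroup.mk_one, Ne, pgl_mk_eq_iff] at hz1 ht1
  have hc := hcomm.eq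
  rw [← QuotientGroup.mk_mul, ← QuotientGroup.mk_mul, pgl_mk_eq_iff] at hc
  obtain ⟨a, ha⟩ := hz2
  obtain ⟨b, hb⟩ := ht2
  obtain ⟨c, hc⟩ := hc
  have hdA : (A : Matrix (Fin 2) (Fin 2) K).det ≠ 0 := A.det.ne_zero
  have hdB : (B : Matrix (Fin 2) (Fin 2) K).det ≠ 0 := B.det.ne_zero
  have hAB : (A : PGL2 K) * (B : PGL2 K) ≠ 1 := by
    intro h
    apply hzt
    have hB : (B : PGL2 K) * (B : PGL2 K) = 1 := by
      rw [← QuotientGroup.mk_mul, ← QuotientGroup.mk_one, pgl_mk_eq_iff]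
      exact ⟨b, hb⟩
    exact mul_right_cancel (h.trans hB.symm)
  rw [← QuotientGroup.mk_mul, ← QuotientGroup.mk_one, Ne, pgl_mk_eq_iff] at hAB
  simp only [Units.val_mul, Units.val_one] at *
  have ha0 : a ≠ 0 := by
    rintro rfl
    have := congrArg Matrix.det ha
    simp at this
    exact hdA (by simpa using this)
  have hb0 : b ≠ 0 := by
    rintro rfl
    have := congrArg Matrix.det hb
    simp at this
    exact hdB (by simpa using this)
  have hc2 : c = 1 ∨ c = -1 := by
    have h := congrArg Matrix.det hc
    rw [Matrix.det_smul, Matrix.det_mul, Matrix.det_mul, Fintype.card_fin] at h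
    have h2 : c ^ 2 = 1 := mul_right_cancel₀ (mul_ne_zero hdB hdA) (by linear_combination -h)
    exact by simpa using h2
  rcases hc2 with rfl | rfl
  · exfalso
    have tA := traceless_of_sq hchar _ a ha hz1
    have tB := traceless_of_sq hchar _ b hb ht1
    have h00 := congrFun (congrFun hc 0) 0
    have h01 := congrFun (congrFun hc 0) 1
    have h10 := congrFun (congrFun hc 1) 0
    simp only [Matrix.mul_apply, Fin.sum_univ_two, one_smul] at h00 h01 h10
    refine hAB ⟨((A : Matrix (Fin 2) (Fin 2) K) * (B : Matrix (Fin 2) (Fin 2) K)) 0 0, ?_⟩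
    rw [tA, tB] at h01 h10
    ext i j
    fin_cases i <;> fin_cases j <;> simp [Matrix.mul_apply, Fin.sum_univ_two, tA, tB]
    · exact mul_left_cancel₀ hchar (by linear_combination h01)
    · exact mul_left_cancel₀ hchar (by linear_combination h10)
    · linear_combination -h00
  · obtain ⟨k, hk⟩ := IsAlgClosed.exists_pow_nat_eq (b / a) (n := 2) (by norm_num)
    have hk' : k * k * a = b := by rw [← sq, hk]; field_simp
    have hk0 : k ≠ 0 := by rintro rfl; apply hb0; rw [← hk']; simp
    set M : Matrix (Fin 2) (Fin 2) K := A.val with hM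
    set N : Matrix (Fin 2) (Fin 2) K := B.val with hN
    have hRR : (k • M + N) * (k • M + N) = (2 * b) • (1 : Matrix (Fin 2) (Fin 2) K) := by
      simp only [add_mul, mul_add, Matrix.smul_mul, Matrix.mul_smul, ha, hb, hc, smul_smul]
      rw [two_mul, add_smul, ← mul_assoc, hk']
      module
    have hdR : (k • M + N).det ≠ 0 := by
      intro h
      have := congrArg Matrix.det hRR
      rw [Matrix.det_mul, h, Matrix.det_smul, Matrix.det_one] at this
      simp at this
      exact pow_ne_zero 2 (mul_ne_zero hchar hb0) this.symm
    refine ⟨((Matrix.GeneralLinearGroup.mkOfDetNeZero (k • M + N) hdR : GL (Fin 2) K) : PGL2 K), ?_, ?_⟩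
    · rw [mul_inv_eq_iff_eq_mul, ← QuotientGroup.mk_mul, ← QuotientGroup.mk_mul, pgl_mk_eq_iff]
      refine ⟨k⁻¹, ?_⟩
      change (k • M + N) * M = k⁻¹ • (N * (k • M + N))
      simp only [add_mul, mul_add, Matrix.smul_mul, Matrix.mul_smul, ha, hb, smul_add, smul_smul]
      rw [← hk', show k⁻¹ * (k * k * a) = k * a by field_simp, inv_mul_cancel₀ hk0]
      module
    · rw [mul_inv_eq_iff_eq_mul, ← QuotientGroup.mk_mul, ← QuotientGroup.mk_mul, pgl_mk_eq_iff]
      refine ⟨k, ?_⟩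
      change (k • M + N) * N = k • (M * (k • M + N))
      simp only [add_mul, mul_add, Matrix.smul_mul, Matrix.mul_smul, ha, hb, smul_add, smul_smul]
      rw [← hk']
      module
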